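/- Let R be any σ-ring and let F and G be subsets of R. Then ⟨F⟩_r ∩ ⟨G⟩_r = ⟨FG⟩_r, where FG := {fg : f ∈ F, g ∈ G}. In particular, for σ-ideals I and J of R, ⟨I⟩_r ∩ ⟨J⟩_r = ⟨I ∩ J⟩_r = ⟨IJ⟩_r. -/

import Mathlib

open Polynomial

section SigmaRing

variable {R : Type*} [CommRing R]

/-- A σ-ideal: an ideal closed under the difference operator σ. -/
def IsSigmaIdeal (σ : R →+* R) (I : Ideal R) : Prop := ∀ a ∈ I, σ a ∈ I

/-- A σ-ideal is well-mixed if `a * b ∈ I` implies `a * σ b ∈ I`. -/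
def IsWellMixed (σ : R →+* R) (I : Ideal R) : Prop := ∀ a b : R, a * b ∈ I → a * σ b ∈ I

/-- `[F]`, the smallest σ-ideal containing `F`. -/
def sigmaIdealGen (σ : R →+* R) (F : Set R) : Ideal R :=
  sInf {I : Ideal R | F ⊆ I ∧ IsSigmaIdeal σ I}

/-- `⟨F⟩`, the smallest well-mixed σ-ideal containing `F` (well-mixed closure). -/
def wmClosure (σ : R →+* R) (F : Set R) : Ideal R :=
  sInf {I : Ideal R | F ⊆ I ∧ IsSigmaIdeal σ I ∧ IsWellMixed σ I}

/-- `⟨F⟩_r`, the smallest radical well-mixed σ-ideal containing `F`. -/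
def rwmClosure (σ : R →+* R) (F : Set R) : Ideal R :=
  sInf {I : Ideal R | F ⊆ I ∧ IsSigmaIdeal σ I ∧ IsWellMixed σ I ∧ I.IsRadical}

/-- Symbolic exponent: for `p = Σ c_i x^i ∈ ℕ[x]`, `a^p = Π (σ^i a)^(c_i)`. -/
noncomputable def sexp (σ : R →+* R) (a : R) (p : Polynomial ℕ) : R :=
  ∏ i ∈ Finset.range (p.natDegree + 1), ((⇑σ)^[i] a) ^ (p.coeff i)

/-- `I` is finitely generated as a radical well-mixed σ-ideal. -/
def FinGenAsRWM (σ : R →+* R) (I : Ideal R) : Prop :=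
  ∃ G : Set R, G.Finite ∧ G ⊆ (I : Set R) ∧ I = rwmClosure σ G

/-- σ-prime: a reflexive σ-ideal which is prime. -/
def IsSigmaPrime (σ : R →+* R) (I : Ideal R) : Prop :=
  IsSigmaIdeal σ I ∧ (∀ a : R, σ a ∈ I → a ∈ I) ∧ I.IsPrime

end SigmaRing

/-- The σ-polynomial ring `K{y_1,…,y_n}`: polynomials in variables `y_i^{x^j}`,
indexed by pairs `(i, j) ∈ Fin n × ℕ`. -/
abbrev DPoly (K : Type*) [Field K] (n : ℕ) := MvPolynomial (Fin n × ℕ) K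

section DPoly

variable {K : Type*} [Field K] {n : ℕ} (σK : K →+* K)

/-- The difference operator on `K{y_1,…,y_n}` extending `σK`, with `σ(y_i^{x^j}) = y_i^{x^{j+1}}`. -/
noncomputable def shift : DPoly K n →+* DPoly K n :=
  MvPolynomial.eval₂Hom ((MvPolynomial.C : K →+* DPoly K n).comp σK)
    (fun v => MvPolynomial.X (v.1, v.2 + 1))

/-- `y_i^p` for `p ∈ ℕ[x]`. -/
noncomputable def ypow (i : Fin n) (p : Polynomial ℕ) : DPoly K n :=
  sexp (shift σK) (MvPolynomial.X (i, 0)) p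

/-- `y_i^{x^a}`. -/
noncomputable def varPow (i : Fin n) (a : ℕ) : DPoly K n :=
  ypow σK i (Polynomial.X ^ a)

/-- The monomial `Y^f = Π y_i^{f_i}` for `f ∈ ℕ[x]^n`. -/
noncomputable def monom (f : Fin n → Polynomial ℕ) : DPoly K n :=
  ∏ i, ypow σK i (f i)

/-- A pure binomial `Y^f − Y^g`. -/
def IsPureBinomial (p : DPoly K n) : Prop :=
  ∃ f g : Fin n → Polynomial ℕ, p = monom σK f - monom σK g

/-- A binomial `a·Y^f + b·Y^g` with `a, b ∈ K^×`. -/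
def IsBinomial (p : DPoly K n) : Prop :=
  ∃ (a b : K) (f g : Fin n → Polynomial ℕ), a ≠ 0 ∧ b ≠ 0 ∧
    p = MvPolynomial.C a * monom σK f + MvPolynomial.C b * monom σK g

/-- A pure binomial σ-ideal: a σ-ideal generated by pure binomials. -/
def IsPureBinomialSigmaIdeal (I : Ideal (DPoly K n)) : Prop :=
  ∃ S : Set (DPoly K n), (∀ p ∈ S, IsPureBinomial σK p) ∧ I = sigmaIdealGen (shift σK) S

/-- Positive part of `f ∈ ℤ[x]`. -/
noncomputable def posPart (f : Polynomial ℤ) : Polynomial ℕ :=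
  f.sum fun i c => Polynomial.monomial i c.toNat

/-- Negative part of `f ∈ ℤ[x]`. -/
noncomputable def negPart (f : Polynomial ℤ) : Polynomial ℕ :=
  f.sum fun i c => Polynomial.monomial i (-c).toNat

/-- The lattice σ-ideal `I_L = [Y^{f_+} − Y^{f_−} : f ∈ L]` of a ℤ[x]-lattice `L ⊆ ℤ[x]^n`. -/
noncomputable def latticeIdeal (L : Submodule (Polynomial ℤ) (Fin n → Polynomial ℤ)) :
    Ideal (DPoly K n) :=
  sigmaIdealGen (shift σK)
    {p | ∃ f ∈ L, p = monom σK (fun i => posPart (f i)) - monom σK (fun i => negPart (f i))}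

end DPoly

/-- `𝔪`: the multiplicatively closed set generated by the variables `y_i^{x^j}`. -/
def mSet (K : Type*) [Field K] (n : ℕ) : Set (DPoly K n) :=
  (Submonoid.closure (Set.range fun v : Fin n × ℕ => (MvPolynomial.X v : DPoly K n)) : Set _)

/-- `I : 𝔪 = {p : M p ∈ I for some M ∈ 𝔪}`. -/
def colonM {K : Type*} [Field K] {n : ℕ} (I : Ideal (DPoly K n)) : Set (DPoly K n) :=
  {p | ∃ M ∈ mSet K n, M * p ∈ I}

section Tsec

variable {K : Type*} [Field K] {n t : ℕ} (σK : K →+* K)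

/-- The set `T^{a_1…a_t}_{j_1…j_t}` of monomials `Y^f` with `deg f_{j_i} < a_i`. -/
def Tset (j : Fin t → Fin n) (a : Fin t → ℕ) : Set (DPoly K n) :=
  {p | ∃ f : Fin n → Polynomial ℕ,
    (∀ i : Fin t, (f (j i)).degree < (a i : WithBot ℕ)) ∧ p = monom σK f}

/-- `I` is saturated with respect to `{y_{j_1}^{x^{a_1}},…,y_{j_t}^{x^{a_t}}}`. -/
def SaturatedWrt (j : Fin t → Fin n) (a : Fin t → ℕ) (I : Ideal (DPoly K n)) : Prop :=
  ∀ g M : DPoly K n, M ∈ Tset σK j a → M * g ∈ I → g ∈ I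

/-- `J : T = {g : M g ∈ J for some M ∈ T}`. -/
def colonT (j : Fin t → Fin n) (a : Fin t → ℕ) (J : Ideal (DPoly K n)) : Set (DPoly K n) :=
  {g | ∃ M ∈ Tset σK j a, M * g ∈ J}

/-- The `T`-saturated closure `N^{a_1…a_t}_{j_1…j_t}(I)`: the smallest saturated σ-ideal
containing `I`. -/
noncomputable def Nclosure (j : Fin t → Fin n) (a : Fin t → ℕ) (I : Ideal (DPoly K n)) :
    Ideal (DPoly K n) :=
  sInf {J : Ideal (DPoly K n) | I ≤ J ∧ IsSigmaIdeal (shift σK) J ∧ SaturatedWrt σK j a J}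

/-- The set of variables `{y_{j_1}^{x^{a_1}},…,y_{j_t}^{x^{a_t}}}`. -/
noncomputable def varSet (j : Fin t → Fin n) (a : Fin t → ℕ) : Set (DPoly K n) :=
  Set.range fun i => varPow σK (j i) (a i)

/-- `⟨I₀ ∪ {y_{j_1}^{x^{a_1}},…,y_{j_t}^{x^{a_t}}}⟩_r` is quasi-normal. -/
def QuasiNormal (j : Fin t → Fin n) (a : Fin t → ℕ) (I0 : Ideal (DPoly K n)) : Prop :=
  SaturatedWrt σK j a I0 ∧
  ∀ f g : Fin n → Polynomial ℕ, monom σK f - monom σK g ∈ I0 →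
    monom σK f ∈ sigmaIdealGen (shift σK) (varSet σK j a) →
    monom σK g ∈ sigmaIdealGen (shift σK) (varSet σK j a)

end Tsec

section RadicalWellMixed

variable {R : Type*} [CommRing R] {σ : R →+* R}

theorem rwmClosure_le {F : Set R} {K : Ideal R} (hF : F ⊆ K) (hσ : IsSigmaIdeal σ K)
    (hw : IsWellMixed σ K) (hr : K.IsRadical) : rwmClosure σ F ≤ K :=
  sInf_le ⟨hF, hσ, hw, hr⟩

theorem rwmClosure_mono {F G : Set R} (h : F ⊆ G) : rwmClosure σ F ≤ rwmClosure σ G :=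
  sInf_le_sInf fun _ hK => ⟨h.trans hK.1, hK.2⟩

/-- If `F * s ⊆ K` for a radical well-mixed ideal `K`, then `⟨F⟩_r * s ⊆ K`, because
the colon ideal `K : s` is again a radical well-mixed σ-ideal. -/
theorem mul_mem_of_mem_rwmClosure {F : Set R} {K : Ideal R} (hw : IsWellMixed σ K)
    (hr : K.IsRadical) {s : R} (hF : ∀ f ∈ F, f * s ∈ K) {x : R} (hx : x ∈ rwmClosure σ F) :
    x * s ∈ K := by
  let L : Ideal R := Submodule.comap (LinearMap.mulRight R s) K
  have hL : ∀ a, a ∈ L ↔ a * s ∈ K := fun a => Iff.rfl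
  refine (hL x).1 (rwmClosure_le (K := L) hF ?_ ?_ ?_ hx)
  · intro a ha
    rw [hL, mul_comm] at *
    exact hw s a ha
  · intro a b hab
    rw [hL, mul_right_comm] at *
    exact hw (a * s) b hab
  · rintro a ⟨n, hn⟩
    rw [hL] at *
    refine hr ⟨n + 1, ?_⟩
    have : (a * s) ^ (n + 1) = (a * s ^ n) * (a ^ n * s) := by ring
    rw [this]
    exact K.mul_mem_left _ hn

theorem rwmClosure_inf (F G : Set R) :
    rwmClosure σ F ⊓ rwmClosure σ G = rwmClosure σ (Set.image2 (· * ·) F G) := by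
  apply le_antisymm
  · rintro x ⟨hxF, hxG⟩
    refine Submodule.mem_sInf.2 fun K ⟨hFG, _, hw, hr⟩ => ?_
    have hmul : x * x ∈ K := by
      refine mul_mem_of_mem_rwmClosure hw hr (fun f hf => ?_) hxF
      rw [mul_comm]
      refine mul_mem_of_mem_rwmClosure hw hr (fun g hg => ?_) hxG
      rw [mul_comm]
      exact hFG ⟨f, hf, g, hg, rfl⟩
    exact hr ⟨2, by rwa [sq]⟩
  · refine le_inf (sInf_le_sInf fun K hK => ⟨?_, hK.2⟩) (sInf_le_sInf fun K hK => ⟨?_, hK.2⟩)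
    · rintro _ ⟨f, hf, g, -, rfl⟩
      exact K.mul_mem_right g (hK.1 hf)
    · rintro _ ⟨f, -, g, hg, rfl⟩
      exact K.mul_mem_left f (hK.1 hg)

end RadicalWellMixed

/-- `⟨F⟩_r ∩ ⟨G⟩_r = ⟨FG⟩_r`, and for σ-ideals `I`, `J`,
`⟨I⟩_r ∩ ⟨J⟩_r = ⟨I ∩ J⟩_r = ⟨IJ⟩_r`. -/
theorem stmt2 {R : Type*} [CommRing R] (σ : R →+* R) (F G : Set R)
    (I J : Ideal R) (hI : IsSigmaIdeal σ I) (hJ : IsSigmaIdeal σ J) :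
    rwmClosure σ F ⊓ rwmClosure σ G = rwmClosure σ (Set.image2 (· * ·) F G) ∧
    rwmClosure σ (I : Set R) ⊓ rwmClosure σ (J : Set R) =
      rwmClosure σ ((I ⊓ J : Ideal R) : Set R) ∧
    rwmClosure σ ((I ⊓ J : Ideal R) : Set R) = rwmClosure σ ((I * J : Ideal R) : Set R) := by
  have hprod : rwmClosure σ (Set.image2 (· * ·) (I : Set R) (J : Set R)) ≤
      rwmClosure σ ((I * J : Ideal R) : Set R) := by
    apply rwmClosure_mono
    rintro _ ⟨f, hf, g, hg, rfl⟩
    exact Ideal.mul_mem_mul hf hg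
  have hmul : rwmClosure σ ((I * J : Ideal R) : Set R) ≤
      rwmClosure σ ((I ⊓ J : Ideal R) : Set R) := rwmClosure_mono Ideal.mul_le_inf
  have hinf : rwmClosure σ ((I ⊓ J : Ideal R) : Set R) ≤
      rwmClosure σ (I : Set R) ⊓ rwmClosure σ (J : Set R) :=
    le_inf (rwmClosure_mono fun _ h => h.1) (rwmClosure_mono fun _ h => h.2)
  have hIJ := rwmClosure_inf (σ := σ) (I : Set R) (J : Set R)
  exact ⟨rwmClosure_inf F G, le_antisymm (hIJ.le.trans (hprod.trans hmul)) hinf,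
    le_antisymm (hinf.trans (hIJ.le.trans hprod)) hmul⟩
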